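/- Let W = {z : Fin 6 → ℂ | (∀ i, z i ≠ 0) ∧ z₁z₅ ≠ z₂z₄ ∧ z₁z₆ ≠ z₃z₄ ∧ z₂z₆ ≠ z₃z₅} (the main stratum of G_{5,2} in the chart M₁₂), with its subspace topology, acted on by (ℂˣ)⁵ as above (the action preserves W). Then the map z ↦ ((z₁z₅ : z₂z₄), (z₁z₆ : z₃z₄), (z₂z₆ : z₃z₅)) ∈ ℂP¹ × ℂP¹ × ℂP¹ is constant on orbits and induces a homeomorphism from the quotient space W / (orbit equivalence of the (ℂˣ)⁵-action), with the quotient topology, onto the space F. (The space of parameters of the main stratum of G_{5,2} is homeomorphic to {((c₁:c₁'),(c₂:c₂'),(c₃:c₃')) ∈ (ℂP¹)³ : c₁c₂'c₃ = c₁'c₂c₃', cᵢ, cᵢ' ≠ 0, cᵢ ≠ cᵢ'}.) -/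

import Mathlib

open scoped LinearAlgebra.Projectivization

/-- The quotient topology on the complex projective line. -/
noncomputable instance : TopologicalSpace (ℙ ℂ (Fin 2 → ℂ)) := instTopologicalSpaceQuotient

/-- The point of the complex projective line with homogeneous coordinates `(a : b)`. -/
noncomputable def pt (a b : ℂ) (h : a ≠ 0 ∨ b ≠ 0) : ℙ ℂ (Fin 2 → ℂ) :=
  Projectivization.mk ℂ ![a, b] (fun hz => by
    rcases h with h | h
    · exact h (by simpa using congrFun hz 0)
    · exact h (by simpa using congrFun hz 1))

/-- The space of parameters `F` of the main stratum of `G_{5,2}`, as a subset of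
`ℂP¹ × ℂP¹ × ℂP¹`: triples `((c₁:c₁'), (c₂:c₂'), (c₃:c₃'))` with `c₁c₂'c₃ = c₁'c₂c₃'` and
`cᵢ, cᵢ' ≠ 0`, `cᵢ ≠ cᵢ'`. -/
def Fset : Set (ℙ ℂ (Fin 2 → ℂ) × ℙ ℂ (Fin 2 → ℂ) × ℙ ℂ (Fin 2 → ℂ)) :=
  {p | ∃ (c₁ c₁' c₂ c₂' c₃ c₃' : ℂ) (h₁ : c₁ ≠ 0) (h₂ : c₂ ≠ 0) (h₃ : c₃ ≠ 0),
    c₁' ≠ 0 ∧ c₂' ≠ 0 ∧ c₃' ≠ 0 ∧ c₁ ≠ c₁' ∧ c₂ ≠ c₂' ∧ c₃ ≠ c₃' ∧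
    c₁ * c₂' * c₃ = c₁' * c₂ * c₃' ∧
    p = (pt c₁ c₁' (Or.inl h₁), pt c₂ c₂' (Or.inl h₂), pt c₃ c₃' (Or.inl h₃))}

/-- The action of the torus `(ℂˣ)⁵` on `ℂ⁶`, the chart `M₁₂` of `G_{5,2}`. -/
noncomputable def chartAct (t : Fin 5 → ℂˣ) (z : Fin 6 → ℂ) : Fin 6 → ℂ :=
  ![(t 0 : ℂ) * z 0, (t 1 : ℂ) * z 1, (t 2 : ℂ) * z 2, (t 3 : ℂ) * z 3,
    (t 1 : ℂ) * (t 3 : ℂ) * (t 0 : ℂ)⁻¹ * z 4, (t 2 : ℂ) * (t 3 : ℂ) * (t 0 : ℂ)⁻¹ * z 5]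

/-- The main stratum `W` of `G_{5,2}` in the chart `M₁₂`. -/
def mainStratum : Type :=
  {z : Fin 6 → ℂ // (∀ i, z i ≠ 0) ∧
    z 0 * z 4 ≠ z 1 * z 3 ∧ z 0 * z 5 ≠ z 2 * z 3 ∧ z 1 * z 5 ≠ z 2 * z 4}

noncomputable instance : TopologicalSpace mainStratum :=
  instTopologicalSpaceSubtype

lemma pt_eq {a b c d : ℂ} (ha : a ≠ 0) (hc : c ≠ 0) (h : a * d = b * c) :
    pt a b (Or.inl ha) = pt c d (Or.inl hc) := by
  unfold pt
  rw [Projectivization.mk_eq_mk_iff']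
  refine ⟨a / c, ?_⟩
  ext i
  fin_cases i
  · simp; field_simp
  · simp; field_simp; linear_combination h

/-- affine coordinate -/
noncomputable def ratio (p : ℙ ℂ (Fin 2 → ℂ)) : ℂ :=
  Projectivization.lift (fun v : {v : Fin 2 → ℂ // v ≠ 0} => v.1 0 / v.1 1) (by
    rintro ⟨a, ha⟩ ⟨b, hb⟩ t h
    have ht : t ≠ 0 := by
      rintro rfl
      apply ha
      simpa using h
    have h : a = t • b := h
    subst h
    simp only [Pi.smul_apply, smul_eq_mul]
    rw [mul_div_mul_left _ _ ht]) p

lemma ratio_pt (a b : ℂ) (h) : ratio (pt a b h) = a / b := by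
  simp [ratio, pt]

/-- quotient map -/
noncomputable def qmk (v : {v : Fin 2 → ℂ // v ≠ 0}) : ℙ ℂ (Fin 2 → ℂ) := Projectivization.mk ℂ v.1 v.2

lemma isQuot : Topology.IsQuotientMap qmk := isQuotientMap_quotient_mk'

lemma continuous_pt {X : Type*} [TopologicalSpace X] {a b : X → ℂ} (ha : Continuous a)
    (hb : Continuous b) (h : ∀ x, a x ≠ 0) :
    Continuous (fun x => pt (a x) (b x) (Or.inl (h x))) := by
  have : Continuous (fun x => (⟨![a x, b x], fun hz => h x (by simpa using congrFun hz 0)⟩ :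
      {v : Fin 2 → ℂ // v ≠ 0})) := by
    refine Continuous.subtype_mk ?_ _
    refine continuous_pi fun i => ?_
    fin_cases i
    · simpa using ha
    · simpa using hb
  exact isQuot.continuous.comp this

/-- affine chart -/
def chartSet : Set (ℙ ℂ (Fin 2 → ℂ)) := {p | ratio p ≠ 0}

lemma qmk_preimage : qmk ⁻¹' chartSet = {v | v.1 0 ≠ 0 ∧ v.1 1 ≠ 0} := by
  ext v
  simp [chartSet, qmk, ratio]

lemma isOpen_pre : IsOpen {v : {v : Fin 2 → ℂ // v ≠ 0} | v.1 0 ≠ 0 ∧ v.1 1 ≠ 0} := by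
  have h0 : Continuous fun v : {v : Fin 2 → ℂ // v ≠ 0} => v.1 0 :=
    (continuous_apply 0).comp continuous_subtype_val
  have h1 : Continuous fun v : {v : Fin 2 → ℂ // v ≠ 0} => v.1 1 :=
    (continuous_apply 1).comp continuous_subtype_val
  exact (isOpen_ne_fun h0 continuous_const).inter (isOpen_ne_fun h1 continuous_const)

lemma continuousOn_ratio : ContinuousOn ratio chartSet := by
  have ho : IsOpen chartSet := by
    rw [← isQuot.isOpen_preimage, qmk_preimage]
    exact isOpen_pre
  rw [isQuot.continuousOn_isOpen_iff ho, qmk_preimage]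
  have h0 : Continuous fun v : {v : Fin 2 → ℂ // v ≠ 0} => v.1 0 :=
    (continuous_apply 0).comp continuous_subtype_val
  have h1 : Continuous fun v : {v : Fin 2 → ℂ // v ≠ 0} => v.1 1 :=
    (continuous_apply 1).comp continuous_subtype_val
  exact h0.continuousOn.div h1.continuousOn (fun v hv => hv.2)

lemma Fset_ratio (p : Fset) : ratio p.1.1 ≠ 0 ∧ ratio p.1.2.1 ≠ 0 ∧ ratio p.1.1 ≠ 1 ∧
    ratio p.1.2.1 ≠ 1 ∧ ratio p.1.2.1 ≠ ratio p.1.1 := by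
  obtain ⟨p, a, a', b, b', c, c', ha, hb, hc, ha', hb', hc', h1, h2, h3, h, rfl⟩ := p
  simp only [ratio_pt]
  refine ⟨div_ne_zero ha ha', div_ne_zero hb hb', ?_, ?_, ?_⟩
  · rwa [Ne, div_eq_one_iff_eq ha']
  · rwa [Ne, div_eq_one_iff_eq hb']
  · rw [Ne, div_eq_div_iff hb' ha']
    intro e
    apply h3
    have : a * b' * (c - c') = 0 := by linear_combination h + c' * e
    simpa [ha, hb', sub_eq_zero] using this

/-- the section -/
noncomputable def sec (p : Fset) : mainStratum :=
  ⟨![1, 1, 1, 1, ratio p.1.1, ratio p.1.2.1], by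
    obtain ⟨h1, h2, h3, h4, h5⟩ := Fset_ratio p
    refine ⟨?_, ?_, ?_, ?_⟩
    · intro i
      fin_cases i <;> simp [h1, h2]
    · simpa using h3
    · simpa using h4
    · simpa using h5⟩

lemma continuous_sec : Continuous sec := by
  refine Continuous.subtype_mk ?_ _
  have h1 : Continuous fun p : Fset => ratio p.1.1 :=
    continuousOn_ratio.comp_continuous (by fun_prop) (fun p => (Fset_ratio p).1)
  have h2 : Continuous fun p : Fset => ratio p.1.2.1 :=
    continuousOn_ratio.comp_continuous (by fun_prop) (fun p => (Fset_ratio p).2.1)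
  refine continuous_pi fun i => ?_
  fin_cases i
  · exact continuous_const
  · exact continuous_const
  · exact continuous_const
  · exact continuous_const
  · exact h1
  · exact h2

/-- the map -/
noncomputable def fwd (z : mainStratum) : Fset :=
  ⟨(pt (z.1 0 * z.1 4) (z.1 1 * z.1 3) (Or.inl (mul_ne_zero (z.2.1 0) (z.2.1 4))),
    pt (z.1 0 * z.1 5) (z.1 2 * z.1 3) (Or.inl (mul_ne_zero (z.2.1 0) (z.2.1 5))),
    pt (z.1 1 * z.1 5) (z.1 2 * z.1 4) (Or.inl (mul_ne_zero (z.2.1 1) (z.2.1 5)))),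
    _, _, _, _, _, _, mul_ne_zero (z.2.1 0) (z.2.1 4), mul_ne_zero (z.2.1 0) (z.2.1 5),
    mul_ne_zero (z.2.1 1) (z.2.1 5), mul_ne_zero (z.2.1 1) (z.2.1 3),
    mul_ne_zero (z.2.1 2) (z.2.1 3), mul_ne_zero (z.2.1 2) (z.2.1 4),
    z.2.2.1, z.2.2.2.1, z.2.2.2.2, by ring, rfl⟩

lemma continuous_fwd : Continuous fwd := by
  refine Continuous.subtype_mk ?_ _
  have hc : ∀ i, Continuous fun z : mainStratum => z.1 i := fun i =>
    (continuous_apply i).comp continuous_subtype_val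
  exact (continuous_pt ((hc 0).mul (hc 4)) ((hc 1).mul (hc 3))
    fun z => mul_ne_zero (z.2.1 0) (z.2.1 4)).prodMk
    ((continuous_pt ((hc 0).mul (hc 5)) ((hc 2).mul (hc 3))
    fun z => mul_ne_zero (z.2.1 0) (z.2.1 5)).prodMk
      (continuous_pt ((hc 1).mul (hc 5)) ((hc 2).mul (hc 4))
    fun z => mul_ne_zero (z.2.1 1) (z.2.1 5)))

lemma fwd_orbit (z w : mainStratum) (h : ∃ t : Fin 5 → ℂˣ, chartAct t z.1 = w.1) :
    fwd z = fwd w := by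
  obtain ⟨t, h⟩ := h
  have e0 : w.1 0 = t 0 * z.1 0 := by rw [← h]; rfl
  have e1 : w.1 1 = t 1 * z.1 1 := by rw [← h]; rfl
  have e2 : w.1 2 = t 2 * z.1 2 := by rw [← h]; rfl
  have e3 : w.1 3 = t 3 * z.1 3 := by rw [← h]; rfl
  have e4 : w.1 4 = t 1 * t 3 * (t 0 : ℂ)⁻¹ * z.1 4 := by rw [← h]; rfl
  have e5 : w.1 5 = t 2 * t 3 * (t 0 : ℂ)⁻¹ * z.1 5 := by rw [← h]; rfl
  have t0 := (t 0).ne_zero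
  apply Subtype.ext
  refine Prod.ext ?_ (Prod.ext ?_ ?_)
  all_goals
    refine pt_eq (mul_ne_zero (z.2.1 _) (z.2.1 _)) (mul_ne_zero (w.2.1 _) (w.2.1 _)) ?_
    simp only [e0, e1, e2, e3, e4, e5]
    field_simp

lemma fwd_sec (p : Fset) : fwd (sec p) = p := by
  apply Subtype.ext
  obtain ⟨p, a, a', b, b', c, c', ha, hb, hc, ha', hb', hc', h1, h2, h3, h, rfl⟩ := p
  refine Prod.ext ?_ (Prod.ext ?_ ?_)
  all_goals
    refine pt_eq (mul_ne_zero ((sec _).2.1 _) ((sec _).2.1 _)) (by assumption) ?_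
    simp [sec, ratio_pt]
    field_simp
  linear_combination -h

lemma sec_fwd (z : mainStratum) : ∃ t : Fin 5 → ℂˣ, chartAct t (sec (fwd z)).1 = z.1 := by
  have hz := z.2.1
  refine ⟨![Units.mk0 _ (hz 0), Units.mk0 _ (hz 1), Units.mk0 _ (hz 2), Units.mk0 _ (hz 3), 1], ?_⟩
  have z0 := hz 0
  have z1 := hz 1
  have z2 := hz 2
  have z3 := hz 3
  ext i
  fin_cases i
  all_goals simp [chartAct, sec, fwd, ratio_pt]
  all_goals field_simp

/-- The map `z ↦ ((z₁z₅ : z₂z₄), (z₁z₆ : z₃z₄), (z₂z₆ : z₃z₅))` is constant on `(ℂˣ)⁵`-orbits of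
the main stratum `W` of `G_{5,2}` (in the chart `M₁₂`) and induces a homeomorphism of the orbit
space `W/(ℂˣ)⁵`, with the quotient topology, onto the space of parameters `F`. -/
theorem mainStratum_parameter_space :
    (∀ z w : mainStratum, (∃ t : Fin 5 → ℂˣ, chartAct t z.1 = w.1) →
      ((pt (z.1 0 * z.1 4) (z.1 1 * z.1 3) (Or.inl (mul_ne_zero (z.2.1 0) (z.2.1 4))),
        pt (z.1 0 * z.1 5) (z.1 2 * z.1 3) (Or.inl (mul_ne_zero (z.2.1 0) (z.2.1 5))),
        pt (z.1 1 * z.1 5) (z.1 2 * z.1 4) (Or.inl (mul_ne_zero (z.2.1 1) (z.2.1 5)))) =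
       (pt (w.1 0 * w.1 4) (w.1 1 * w.1 3) (Or.inl (mul_ne_zero (w.2.1 0) (w.2.1 4))),
        pt (w.1 0 * w.1 5) (w.1 2 * w.1 3) (Or.inl (mul_ne_zero (w.2.1 0) (w.2.1 5))),
        pt (w.1 1 * w.1 5) (w.1 2 * w.1 4) (Or.inl (mul_ne_zero (w.2.1 1) (w.2.1 5)))))) ∧
    ∃ h : (Quot fun z w : mainStratum => ∃ t : Fin 5 → ℂˣ, chartAct t z.1 = w.1) ≃ₜ Fset,
      ∀ z : mainStratum,
        (h (Quot.mk _ z) : ℙ ℂ (Fin 2 → ℂ) × ℙ ℂ (Fin 2 → ℂ) × ℙ ℂ (Fin 2 → ℂ)) =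
          (pt (z.1 0 * z.1 4) (z.1 1 * z.1 3) (Or.inl (mul_ne_zero (z.2.1 0) (z.2.1 4))),
           pt (z.1 0 * z.1 5) (z.1 2 * z.1 3) (Or.inl (mul_ne_zero (z.2.1 0) (z.2.1 5))),
           pt (z.1 1 * z.1 5) (z.1 2 * z.1 4) (Or.inl (mul_ne_zero (z.2.1 1) (z.2.1 5)))) := by
  refine ⟨fun z w h => congrArg Subtype.val (fwd_orbit z w h), ?_⟩
  refine ⟨{ toFun := Quot.lift fwd fwd_orbit
            invFun := fun p => Quot.mk _ (sec p)
            left_inv := ?_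
            right_inv := fun p => fwd_sec p
            continuous_toFun := continuous_quot_lift fwd_orbit continuous_fwd
            continuous_invFun := continuous_quot_mk.comp continuous_sec }, fun z => rfl⟩
  rintro ⟨z⟩
  exact Quot.sound (sec_fwd z)
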